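/- arXiv:1211.5425 — 7 statements merged into one kernel-verified Lean document; each statement's English description precedes it below -/
import Mathlib

section
/- For every n ≥ 1 and every fixed h ∈ 𝒮H, a ∈ 𝒮A, e_b ∈ {0,…,Emax}, e ∈ 𝒮E, the value-iteration function q ↦ V_n(q, h, a, e_b, e) is strictly increasing in the queue length q ∈ ℕ (in particular V_n(q, h, a, e_b, e) < V_n(q+1, h, a, e_b, e) for all q ∈ ℕ). -/
open Finset

/-- One-step objective of the discounted value iteration: state `(q,h,a,e_b,e)`,
action `(u,η)` (remaining data `u = q − r`, remaining battery energy `η = e_b − wτ`),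
`Vprev` is the previous iterate. -/
noncomputable def dpObj {SH SA SE : Type*} [Fintype SH] [Fintype SA] [Fintype SE]
    (G : SH → ℝ) (arr : SA → ℕ) (en : SE → ℕ)
    (PH : SH → SH → ℝ) (PA : SA → SA → ℝ) (PE : SE → SE → ℝ)
    (ρ σ2 θ C τ β α : ℝ) (Emax : ℕ)
    (Vprev : ℕ → SH → SA → ℕ → SE → ℝ)
    (q : ℕ) (h : SH) (a : SA) (eb : ℕ) (e : SE) (u η : ℕ) : ℝ :=
  (q : ℝ)
    + β * max (ρ * (σ2 / G h) * (Real.exp (θ * ((q - u : ℕ) : ℝ)) - 1)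
        + (if q - u = 0 then 0 else C)
        - ((eb - η : ℕ) : ℝ) / τ) 0
    + α * ∑ h' : SH, ∑ a' : SA, ∑ e' : SE,
        PH h h' * PA a a' * PE e e' *
          Vprev (u + arr a') h' a' (min (η + en e') Emax) e'

/-- Value iteration `V_0 ≡ 0`,
`V_{n+1}(q,h,a,e_b,e) = min_{u ∈ {0,…,q}, η ∈ {0,…,e_b}} dpObj … u η`. -/
noncomputable def dpV {SH SA SE : Type*} [Fintype SH] [Fintype SA] [Fintype SE]
    (G : SH → ℝ) (arr : SA → ℕ) (en : SE → ℕ)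
    (PH : SH → SH → ℝ) (PA : SA → SA → ℝ) (PE : SE → SE → ℝ)
    (ρ σ2 θ C τ β α : ℝ) (Emax : ℕ) :
    ℕ → ℕ → SH → SA → ℕ → SE → ℝ
  | 0 => fun _ _ _ _ _ => 0
  | n + 1 => fun q h a eb e =>
      (Finset.range (q + 1) ×ˢ Finset.range (eb + 1)).inf'
        ⟨(0, 0), by simp⟩
        (fun p => dpObj G arr en PH PA PE ρ σ2 θ C τ β α Emax
          (dpV G arr en PH PA PE ρ σ2 θ C τ β α Emax n) q h a eb e p.1 p.2)

theorem dpObj_lt_aux {SH SA SE : Type*} [Fintype SH] [Fintype SA] [Fintype SE]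
    (G : SH → ℝ) (hG : ∀ h, 0 < G h)
    (arr : SA → ℕ) (en : SE → ℕ)
    (PH : SH → SH → ℝ) (PA : SA → SA → ℝ) (PE : SE → SE → ℝ)
    (hPH0 : ∀ h h', 0 ≤ PH h h')
    (hPA0 : ∀ a a', 0 ≤ PA a a')
    (hPE0 : ∀ e e', 0 ≤ PE e e')
    (ρ σ2 θ C τ β α : ℝ) (Emax : ℕ)
    (hρ : 1 ≤ ρ) (hσ2 : 0 < σ2) (hθ : 0 < θ) (hC : 0 ≤ C)
    (hβ : 0 < β) (hα0 : 0 < α)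
    (V : ℕ → SH → SA → ℕ → SE → ℝ)
    (hV : ∀ h a eb e, Monotone fun q => V q h a eb e)
    (q : ℕ) (h : SH) (a : SA) (eb : ℕ) (e : SE) (u η : ℕ) :
    dpObj G arr en PH PA PE ρ σ2 θ C τ β α Emax V q h a eb e (u - 1) η <
    dpObj G arr en PH PA PE ρ σ2 θ C τ β α Emax V (q + 1) h a eb e u η := by
  unfold dpObj
  have hd : q - (u - 1) ≤ q + 1 - u := by omega
  have hdr : ((q - (u - 1) : ℕ) : ℝ) ≤ ((q + 1 - u : ℕ) : ℝ) := by exact_mod_cast hd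
  have h1 : ρ * (σ2 / G h) * (Real.exp (θ * ((q - (u - 1) : ℕ) : ℝ)) - 1) ≤
      ρ * (σ2 / G h) * (Real.exp (θ * ((q + 1 - u : ℕ) : ℝ)) - 1) := by
    have := hG h
    have : 0 ≤ ρ * (σ2 / G h) := by positivity
    gcongr
  have h2 : (if q - (u - 1) = 0 then 0 else C) ≤ (if q + 1 - u = 0 then 0 else C) := by
    split_ifs
    · exact le_rfl
    · exact hC
    · omega
    · exact le_rfl
  have h3 : ∑ h' : SH, ∑ a' : SA, ∑ e' : SE, PH h h' * PA a a' * PE e e' *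
        V (u - 1 + arr a') h' a' (min (η + en e') Emax) e' ≤
      ∑ h' : SH, ∑ a' : SA, ∑ e' : SE, PH h h' * PA a a' * PE e e' *
        V (u + arr a') h' a' (min (η + en e') Emax) e' := by
    refine sum_le_sum fun h' _ => sum_le_sum fun a' _ => sum_le_sum fun e' _ => ?_
    refine mul_le_mul_of_nonneg_left (hV _ _ _ _ (by omega))
      (mul_nonneg (mul_nonneg (hPH0 _ _) (hPA0 _ _)) (hPE0 _ _))
  have h4 := mul_le_mul_of_nonneg_left h3 hα0.le
  have h5 := mul_le_mul_of_nonneg_left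
    (max_le_max_right 0 (sub_le_sub_right (add_le_add h1 h2) (((eb - η : ℕ) : ℝ) / τ))) hβ.le
  have h6 : (q : ℝ) < ((q + 1 : ℕ) : ℝ) := by push_cast; linarith
  exact add_lt_add_of_lt_of_le (add_lt_add_of_lt_of_le h6 h5) h4

/-- Property 1 of the paper: for every `n ≥ 1` and fixed `h, a, e_b ≤ Emax, e`, the
value-iteration function `q ↦ V_n(q,h,a,e_b,e)` is strictly increasing in the queue
length `q`. -/
theorem dpV_strictMono_in_q {SH SA SE : Type*}
    [Fintype SH] [Fintype SA] [Fintype SE]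
    [Nonempty SH] [Nonempty SA] [Nonempty SE]
    (G : SH → ℝ) (hG : ∀ h, 0 < G h)
    (arr : SA → ℕ) (en : SE → ℕ)
    (PH : SH → SH → ℝ) (PA : SA → SA → ℝ) (PE : SE → SE → ℝ)
    (hPH0 : ∀ h h', 0 ≤ PH h h') (hPH1 : ∀ h, ∑ h' : SH, PH h h' = 1)
    (hPA0 : ∀ a a', 0 ≤ PA a a') (hPA1 : ∀ a, ∑ a' : SA, PA a a' = 1)
    (hPE0 : ∀ e e', 0 ≤ PE e e') (hPE1 : ∀ e, ∑ e' : SE, PE e e' = 1)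
    (ρ σ2 θ C τ β α : ℝ) (Emax : ℕ)
    (hρ : 1 ≤ ρ) (hσ2 : 0 < σ2) (hθ : 0 < θ) (hC : 0 ≤ C) (hτ : 0 < τ)
    (hβ : 0 < β) (hα0 : 0 < α) (hα1 : α < 1)
    (n : ℕ) (hn : 1 ≤ n) (h : SH) (a : SA) (eb : ℕ) (heb : eb ≤ Emax) (e : SE) :
    ∀ q : ℕ, dpV G arr en PH PA PE ρ σ2 θ C τ β α Emax n q h a eb e <
      dpV G arr en PH PA PE ρ σ2 θ C τ β α Emax n (q + 1) h a eb e := by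
  have step : ∀ m : ℕ, (∀ h a eb e, Monotone fun q =>
      dpV G arr en PH PA PE ρ σ2 θ C τ β α Emax m q h a eb e) →
      ∀ h a eb e q, dpV G arr en PH PA PE ρ σ2 θ C τ β α Emax (m + 1) q h a eb e <
        dpV G arr en PH PA PE ρ σ2 θ C τ β α Emax (m + 1) (q + 1) h a eb e := by
    intro m hm h a eb e q
    simp only [dpV]
    refine (Finset.lt_inf'_iff _).2 ?_
    rintro ⟨u, η⟩ hp
    simp only [mem_product, mem_range] at hp
    refine lt_of_le_of_lt (Finset.inf'_le _ (b := (u - 1, η)) ?_)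
      (dpObj_lt_aux G hG arr en PH PA PE hPH0 hPA0 hPE0 ρ σ2 θ C τ β α Emax hρ hσ2 hθ hC
        hβ hα0 _ hm q h a eb e u η)
    simp only [mem_product, mem_range]
    omega
  have mono : ∀ m : ℕ, ∀ h a eb e, Monotone fun q =>
      dpV G arr en PH PA PE ρ σ2 θ C τ β α Emax m q h a eb e := by
    intro m
    induction m with
    | zero => intro h a eb e x y _; simp [dpV]
    | succ k ih => intro h a eb e; exact monotone_nat_of_le_succ fun q => (step k ih h a eb e q).le
  obtain ⟨m, rfl⟩ : ∃ m, n = m + 1 := ⟨n - 1, by omega⟩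
  exact step m (mono m) h a eb e
end

section
/- For every n ≥ 0 and every fixed q ∈ ℕ, h ∈ 𝒮H, a ∈ 𝒮A, e ∈ 𝒮E, the value-iteration function e_b ↦ V_n(q, h, a, e_b, e) is monotone non-increasing in the battery level e_b ∈ {0,…,Emax} (i.e. V_n(q, h, a, e_b + 1, e) ≤ V_n(q, h, a, e_b, e) whenever e_b + 1 ≤ Emax). -/
open Finset

/-- Property 2 of the paper: for every `n ≥ 0` and fixed `q, h, a, e`, the value-iteration
function `e_b ↦ V_n(q,h,a,e_b,e)` is monotone non-increasing in the battery level
`e_b ∈ {0,…,Emax}`. -/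
theorem dpV_antitone_in_eb {SH SA SE : Type*}
    [Fintype SH] [Fintype SA] [Fintype SE]
    [Nonempty SH] [Nonempty SA] [Nonempty SE]
    (G : SH → ℝ) (hG : ∀ h, 0 < G h)
    (arr : SA → ℕ) (en : SE → ℕ)
    (PH : SH → SH → ℝ) (PA : SA → SA → ℝ) (PE : SE → SE → ℝ)
    (hPH0 : ∀ h h', 0 ≤ PH h h') (hPH1 : ∀ h, ∑ h' : SH, PH h h' = 1)
    (hPA0 : ∀ a a', 0 ≤ PA a a') (hPA1 : ∀ a, ∑ a' : SA, PA a a' = 1)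
    (hPE0 : ∀ e e', 0 ≤ PE e e') (hPE1 : ∀ e, ∑ e' : SE, PE e e' = 1)
    (ρ σ2 θ C τ β α : ℝ) (Emax : ℕ)
    (hρ : 1 ≤ ρ) (hσ2 : 0 < σ2) (hθ : 0 < θ) (hC : 0 ≤ C) (hτ : 0 < τ)
    (hβ : 0 < β) (hα0 : 0 < α) (hα1 : α < 1)
    (n : ℕ) (q : ℕ) (h : SH) (a : SA) (e : SE)
    (eb : ℕ) (heb : eb + 1 ≤ Emax) :
    dpV G arr en PH PA PE ρ σ2 θ C τ β α Emax n q h a (eb + 1) e ≤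
      dpV G arr en PH PA PE ρ σ2 θ C τ β α Emax n q h a eb e := by
  cases n with
  | zero => simp [dpV]
  | succ n =>
    simp only [dpV]
    apply Finset.le_inf'
    intro p hp
    have hp' : p ∈ Finset.range (q + 1) ×ˢ Finset.range (eb + 1 + 1) := by
      simp only [Finset.mem_product, Finset.mem_range] at hp ⊢
      omega
    refine (Finset.inf'_le _ hp').trans ?_
    have h1 : ((eb - p.2 : ℕ) : ℝ) ≤ ((eb + 1 - p.2 : ℕ) : ℝ) := by
      exact_mod_cast (by omega : eb - p.2 ≤ eb + 1 - p.2)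
    unfold dpObj
    gcongr
end

section
/- For every n ≥ 0 and every fixed h ∈ 𝒮H, a ∈ 𝒮A, e ∈ 𝒮E, the value-iteration function (q, e_b) ↦ W_n(q, h, a, e_b, e) is convex on [0, ∞) × [0, Emax]: for all φ ∈ [0,1] and all (q1, e1), (q2, e2) ∈ [0,∞) × [0, Emax], W_n(φ·q1 + (1−φ)·q2, h, a, φ·e1 + (1−φ)·e2, e) ≤ φ·W_n(q1, h, a, e1, e) + (1−φ)·W_n(q2, h, a, e2, e). -/
open Finset

/-- Continuous-action relaxation of the discounted value iteration (no circuit power):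
`W_0 ≡ 0` and `W_{n+1}(q,h,a,e_b,e)` is the infimum over `u ∈ [0,q]`, `η ∈ [0,e_b]` of
the one-step cost plus discounted expected continuation cost. -/
noncomputable def ctsW {SH SA SE : Type*} [Fintype SH] [Fintype SA] [Fintype SE]
    (G : SH → ℝ) (arr : SA → ℝ) (en : SE → ℝ)
    (PH : SH → SH → ℝ) (PA : SA → SA → ℝ) (PE : SE → SE → ℝ)
    (ρ σ2 θ τ β α Emax : ℝ) :
    ℕ → ℝ → SH → SA → ℝ → SE → ℝ
  | 0 => fun _ _ _ _ _ => 0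
  | n + 1 => fun q h a eb e =>
      sInf {z : ℝ | ∃ u ∈ Set.Icc (0 : ℝ) q, ∃ η ∈ Set.Icc (0 : ℝ) eb,
        z = q
          + β * max (ρ * (σ2 / G h) * (Real.exp (θ * (q - u)) - 1) - (eb - η) / τ) 0
          + α * ∑ h' : SH, ∑ a' : SA, ∑ e' : SE,
              PH h h' * PA a a' * PE e e' *
                ctsW G arr en PH PA PE ρ σ2 θ τ β α Emax n
                  (u + arr a') h' a' (min (η + en e') Emax) e'}

lemma ctsW_nonneg {SH SA SE : Type*}
    [Fintype SH] [Fintype SA] [Fintype SE]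
    (G : SH → ℝ) (arr : SA → ℝ) (harr : ∀ a, 0 ≤ arr a) (en : SE → ℝ)
    (PH : SH → SH → ℝ) (PA : SA → SA → ℝ) (PE : SE → SE → ℝ)
    (hPH0 : ∀ h h', 0 ≤ PH h h') (hPA0 : ∀ a a', 0 ≤ PA a a') (hPE0 : ∀ e e', 0 ≤ PE e e')
    (ρ σ2 θ τ β α Emax : ℝ) (hβ : 0 < β) (hα0 : 0 < α) (n : ℕ) :
    ∀ (q : ℝ) (h : SH) (a : SA) (eb : ℝ) (e : SE), 0 ≤ q →
      0 ≤ ctsW G arr en PH PA PE ρ σ2 θ τ β α Emax n q h a eb e := by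
  induction n with
  | zero => intro q h a eb e hq; simp [ctsW]
  | succ n ih =>
    intro q h a eb e hq
    rw [ctsW]
    apply Real.sInf_nonneg
    rintro z ⟨u, hu, η, hη, rfl⟩
    have h1 := mul_nonneg hβ.le
      (le_max_right (ρ * (σ2 / G h) * (Real.exp (θ * (q - u)) - 1) - (eb - η) / τ) 0)
    have h2 : 0 ≤ ∑ h' : SH, ∑ a' : SA, ∑ e' : SE,
              PH h h' * PA a a' * PE e e' *
                ctsW G arr en PH PA PE ρ σ2 θ τ β α Emax n
                  (u + arr a') h' a' (min (η + en e') Emax) e' :=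
      Finset.sum_nonneg fun h' _ => Finset.sum_nonneg fun a' _ => Finset.sum_nonneg fun e' _ =>
        mul_nonneg (mul_nonneg (mul_nonneg (hPH0 _ _) (hPA0 _ _)) (hPE0 _ _))
          (ih _ _ _ _ _ (add_nonneg hu.1 (harr _)))
    have h3 := mul_nonneg hα0.le h2
    linarith

lemma ctsW_succ_le {SH SA SE : Type*}
    [Fintype SH] [Fintype SA] [Fintype SE]
    (G : SH → ℝ) (arr : SA → ℝ) (harr : ∀ a, 0 ≤ arr a) (en : SE → ℝ)
    (PH : SH → SH → ℝ) (PA : SA → SA → ℝ) (PE : SE → SE → ℝ)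
    (hPH0 : ∀ h h', 0 ≤ PH h h') (hPA0 : ∀ a a', 0 ≤ PA a a') (hPE0 : ∀ e e', 0 ≤ PE e e')
    (ρ σ2 θ τ β α Emax : ℝ) (hβ : 0 < β) (hα0 : 0 < α) (n : ℕ)
    (q : ℝ) (h : SH) (a : SA) (eb : ℝ) (e : SE) (hq : 0 ≤ q)
    (u η : ℝ) (hu : u ∈ Set.Icc (0 : ℝ) q) (hη : η ∈ Set.Icc (0 : ℝ) eb) :
    ctsW G arr en PH PA PE ρ σ2 θ τ β α Emax (n + 1) q h a eb e ≤
      q + β * max (ρ * (σ2 / G h) * (Real.exp (θ * (q - u)) - 1) - (eb - η) / τ) 0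
          + α * ∑ h' : SH, ∑ a' : SA, ∑ e' : SE,
              PH h h' * PA a a' * PE e e' *
                ctsW G arr en PH PA PE ρ σ2 θ τ β α Emax n
                  (u + arr a') h' a' (min (η + en e') Emax) e' := by
  rw [ctsW]
  refine csInf_le ⟨0, ?_⟩ ⟨u, hu, η, hη, rfl⟩
  rintro z ⟨u, hu, η, hη, rfl⟩
  have h1 := mul_nonneg hβ.le
    (le_max_right (ρ * (σ2 / G h) * (Real.exp (θ * (q - u)) - 1) - (eb - η) / τ) 0)
  have h2 : 0 ≤ ∑ h' : SH, ∑ a' : SA, ∑ e' : SE,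
            PH h h' * PA a a' * PE e e' *
              ctsW G arr en PH PA PE ρ σ2 θ τ β α Emax n
                (u + arr a') h' a' (min (η + en e') Emax) e' :=
    Finset.sum_nonneg fun h' _ => Finset.sum_nonneg fun a' _ => Finset.sum_nonneg fun e' _ =>
      mul_nonneg (mul_nonneg (mul_nonneg (hPH0 _ _) (hPA0 _ _)) (hPE0 _ _))
        (ctsW_nonneg G arr harr en PH PA PE hPH0 hPA0 hPE0 ρ σ2 θ τ β α Emax hβ hα0 n
          _ _ _ _ _ (add_nonneg hu.1 (harr _)))
  have h3 := mul_nonneg hα0.le h2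
  linarith

lemma ctsW_succ_approx {SH SA SE : Type*}
    [Fintype SH] [Fintype SA] [Fintype SE]
    (G : SH → ℝ) (arr : SA → ℝ) (en : SE → ℝ)
    (PH : SH → SH → ℝ) (PA : SA → SA → ℝ) (PE : SE → SE → ℝ)
    (ρ σ2 θ τ β α Emax : ℝ) (n : ℕ)
    (q : ℝ) (h : SH) (a : SA) (eb : ℝ) (e : SE) (hq : 0 ≤ q) (heb : 0 ≤ eb)
    (ε : ℝ) (hε : 0 < ε) :
    ∃ u ∈ Set.Icc (0 : ℝ) q, ∃ η ∈ Set.Icc (0 : ℝ) eb,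
      q + β * max (ρ * (σ2 / G h) * (Real.exp (θ * (q - u)) - 1) - (eb - η) / τ) 0
          + α * ∑ h' : SH, ∑ a' : SA, ∑ e' : SE,
              PH h h' * PA a a' * PE e e' *
                ctsW G arr en PH PA PE ρ σ2 θ τ β α Emax n
                  (u + arr a') h' a' (min (η + en e') Emax) e' <
      ctsW G arr en PH PA PE ρ σ2 θ τ β α Emax (n + 1) q h a eb e + ε := by
  rw [ctsW]
  obtain ⟨z, ⟨u, hu, η, hη, rfl⟩, hz⟩ := Real.lt_sInf_add_pos
    (s := {z : ℝ | ∃ u ∈ Set.Icc (0 : ℝ) q, ∃ η ∈ Set.Icc (0 : ℝ) eb,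
        z = q
          + β * max (ρ * (σ2 / G h) * (Real.exp (θ * (q - u)) - 1) - (eb - η) / τ) 0
          + α * ∑ h' : SH, ∑ a' : SA, ∑ e' : SE,
              PH h h' * PA a a' * PE e e' *
                ctsW G arr en PH PA PE ρ σ2 θ τ β α Emax n
                  (u + arr a') h' a' (min (η + en e') Emax) e'})
    ⟨_, 0, ⟨le_rfl, hq⟩, 0, ⟨le_rfl, heb⟩, rfl⟩ hε
  exact ⟨u, hu, η, hη, hz⟩

lemma ctsW_antitone {SH SA SE : Type*}
    [Fintype SH] [Fintype SA] [Fintype SE]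
    (G : SH → ℝ) (arr : SA → ℝ) (harr : ∀ a, 0 ≤ arr a) (en : SE → ℝ)
    (PH : SH → SH → ℝ) (PA : SA → SA → ℝ) (PE : SE → SE → ℝ)
    (hPH0 : ∀ h h', 0 ≤ PH h h') (hPA0 : ∀ a a', 0 ≤ PA a a') (hPE0 : ∀ e e', 0 ≤ PE e e')
    (ρ σ2 θ τ β α Emax : ℝ) (hτ : 0 < τ) (hβ : 0 < β) (hα0 : 0 < α) (n : ℕ)
    (q : ℝ) (h : SH) (a : SA) (x y : ℝ) (e : SE) (hq : 0 ≤ q) (hx : 0 ≤ x) (hxy : x ≤ y) :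
    ctsW G arr en PH PA PE ρ σ2 θ τ β α Emax n q h a y e ≤
      ctsW G arr en PH PA PE ρ σ2 θ τ β α Emax n q h a x e := by
  cases n with
  | zero => simp [ctsW]
  | succ n =>
    refine le_of_forall_pos_le_add fun ε hε => ?_
    obtain ⟨u, hu, η, hη, hz⟩ := ctsW_succ_approx G arr en PH PA PE ρ σ2 θ τ β α Emax n
      q h a x e hq hx ε hε
    refine le_trans ?_ hz.le
    refine le_trans (ctsW_succ_le G arr harr en PH PA PE hPH0 hPA0 hPE0 ρ σ2 θ τ β α Emax hβ hα0 n
      q h a y e hq u η hu ⟨hη.1, hη.2.trans hxy⟩) ?_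
    gcongr

/-- Property 3 of the paper: for every `n ≥ 0` and fixed `h, a, e`, the relaxed
value-iteration function `(q, e_b) ↦ W_n(q,h,a,e_b,e)` is jointly convex on
`[0,∞) × [0,Emax]`. -/
theorem ctsW_jointly_convex {SH SA SE : Type*}
    [Fintype SH] [Fintype SA] [Fintype SE]
    [Nonempty SH] [Nonempty SA] [Nonempty SE]
    (G : SH → ℝ) (hG : ∀ h, 0 < G h)
    (arr : SA → ℝ) (harr : ∀ a, 0 ≤ arr a)
    (en : SE → ℝ) (hen : ∀ e, 0 ≤ en e)
    (PH : SH → SH → ℝ) (PA : SA → SA → ℝ) (PE : SE → SE → ℝ)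
    (hPH0 : ∀ h h', 0 ≤ PH h h') (hPH1 : ∀ h, ∑ h' : SH, PH h h' = 1)
    (hPA0 : ∀ a a', 0 ≤ PA a a') (hPA1 : ∀ a, ∑ a' : SA, PA a a' = 1)
    (hPE0 : ∀ e e', 0 ≤ PE e e') (hPE1 : ∀ e, ∑ e' : SE, PE e e' = 1)
    (ρ σ2 θ τ β α Emax : ℝ)
    (hρ : 1 ≤ ρ) (hσ2 : 0 < σ2) (hθ : 0 < θ) (hτ : 0 < τ)
    (hβ : 0 < β) (hα0 : 0 < α) (hα1 : α < 1) (hEmax : 0 < Emax)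
    (n : ℕ) (h : SH) (a : SA) (e : SE)
    (φ : ℝ) (hφ : φ ∈ Set.Icc (0 : ℝ) 1)
    (q1 q2 : ℝ) (hq1 : 0 ≤ q1) (hq2 : 0 ≤ q2)
    (e1 e2 : ℝ) (he1 : e1 ∈ Set.Icc (0 : ℝ) Emax) (he2 : e2 ∈ Set.Icc (0 : ℝ) Emax) :
    ctsW G arr en PH PA PE ρ σ2 θ τ β α Emax n
        (φ * q1 + (1 - φ) * q2) h a (φ * e1 + (1 - φ) * e2) e ≤
      φ * ctsW G arr en PH PA PE ρ σ2 θ τ β α Emax n q1 h a e1 e +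
        (1 - φ) * ctsW G arr en PH PA PE ρ σ2 θ τ β α Emax n q2 h a e2 e := by
  induction n generalizing h a e φ q1 q2 e1 e2 with
  | zero => simp [ctsW]
  | succ n ih =>
    obtain ⟨hφ0, hφ1⟩ := hφ
    have hψ0 : 0 ≤ 1 - φ := by linarith
    refine le_of_forall_pos_le_add fun ε hε => ?_
    obtain ⟨u1, hu1, η1, hη1, hz1⟩ := ctsW_succ_approx G arr en PH PA PE ρ σ2 θ τ β α Emax n
      q1 h a e1 e hq1 he1.1 ε hε
    obtain ⟨u2, hu2, η2, hη2, hz2⟩ := ctsW_succ_approx G arr en PH PA PE ρ σ2 θ τ β α Emax n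
      q2 h a e2 e hq2 he2.1 ε hε
    have hmixq : 0 ≤ φ * q1 + (1 - φ) * q2 := by positivity
    have hle := ctsW_succ_le G arr harr en PH PA PE hPH0 hPA0 hPE0 ρ σ2 θ τ β α Emax hβ hα0 n
      (φ * q1 + (1 - φ) * q2) h a (φ * e1 + (1 - φ) * e2) e hmixq
      (φ * u1 + (1 - φ) * u2) (φ * η1 + (1 - φ) * η2)
      ⟨add_nonneg (mul_nonneg hφ0 hu1.1) (mul_nonneg hψ0 hu2.1),
        add_le_add (mul_le_mul_of_nonneg_left hu1.2 hφ0) (mul_le_mul_of_nonneg_left hu2.2 hψ0)⟩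
      ⟨add_nonneg (mul_nonneg hφ0 hη1.1) (mul_nonneg hψ0 hη2.1),
        add_le_add (mul_le_mul_of_nonneg_left hη1.2 hφ0) (mul_le_mul_of_nonneg_left hη2.2 hψ0)⟩
    -- continuation cost
    have hsum : ∑ h' : SH, ∑ a' : SA, ∑ e' : SE,
              PH h h' * PA a a' * PE e e' *
                ctsW G arr en PH PA PE ρ σ2 θ τ β α Emax n
                  ((φ * u1 + (1 - φ) * u2) + arr a') h' a'
                    (min ((φ * η1 + (1 - φ) * η2) + en e') Emax) e' ≤
        φ * (∑ h' : SH, ∑ a' : SA, ∑ e' : SE,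
              PH h h' * PA a a' * PE e e' *
                ctsW G arr en PH PA PE ρ σ2 θ τ β α Emax n
                  (u1 + arr a') h' a' (min (η1 + en e') Emax) e') +
        (1 - φ) * (∑ h' : SH, ∑ a' : SA, ∑ e' : SE,
              PH h h' * PA a a' * PE e e' *
                ctsW G arr en PH PA PE ρ σ2 θ τ β α Emax n
                  (u2 + arr a') h' a' (min (η2 + en e') Emax) e') := by
      simp only [Finset.mul_sum, ← Finset.sum_add_distrib]
      refine Finset.sum_le_sum fun h' _ => Finset.sum_le_sum fun a' _ =>
        Finset.sum_le_sum fun e' _ => ?_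
      have hP : 0 ≤ PH h h' * PA a a' * PE e e' :=
        mul_nonneg (mul_nonneg (hPH0 _ _) (hPA0 _ _)) (hPE0 _ _)
      have hv1 : 0 ≤ u1 + arr a' := add_nonneg hu1.1 (harr _)
      have hv2 : 0 ≤ u2 + arr a' := add_nonneg hu2.1 (harr _)
      have hm1 : min (η1 + en e') Emax ∈ Set.Icc (0 : ℝ) Emax :=
        ⟨le_min (add_nonneg hη1.1 (hen _)) hEmax.le, min_le_right _ _⟩
      have hm2 : min (η2 + en e') Emax ∈ Set.Icc (0 : ℝ) Emax :=
        ⟨le_min (add_nonneg hη2.1 (hen _)) hEmax.le, min_le_right _ _⟩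
      have hc := ih h' a' e' φ ⟨hφ0, hφ1⟩ (u1 + arr a') (u2 + arr a') hv1 hv2 _ _ hm1 hm2
      have hq : φ * (u1 + arr a') + (1 - φ) * (u2 + arr a') =
          (φ * u1 + (1 - φ) * u2) + arr a' := by ring
      rw [hq] at hc
      have hmin : φ * min (η1 + en e') Emax + (1 - φ) * min (η2 + en e') Emax ≤
          min ((φ * η1 + (1 - φ) * η2) + en e') Emax := by
        apply le_min
        · have := mul_le_mul_of_nonneg_left (min_le_left (η1 + en e') Emax) hφ0
          have := mul_le_mul_of_nonneg_left (min_le_left (η2 + en e') Emax) hψ0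
          linarith
        · have := mul_le_mul_of_nonneg_left (min_le_right (η1 + en e') Emax) hφ0
          have := mul_le_mul_of_nonneg_left (min_le_right (η2 + en e') Emax) hψ0
          linarith
      have hanti := ctsW_antitone G arr harr en PH PA PE hPH0 hPA0 hPE0 ρ σ2 θ τ β α Emax hτ hβ hα0
        n ((φ * u1 + (1 - φ) * u2) + arr a') h' a' _ _ e'
        (by rw [← hq]; positivity)
        (add_nonneg (mul_nonneg hφ0 hm1.1) (mul_nonneg hψ0 hm2.1)) hmin
      have := mul_le_mul_of_nonneg_left (hanti.trans hc) hP
      linarith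
    -- stage cost
    have hexp : Real.exp (θ * ((φ * q1 + (1 - φ) * q2) - (φ * u1 + (1 - φ) * u2))) ≤
        φ * Real.exp (θ * (q1 - u1)) + (1 - φ) * Real.exp (θ * (q2 - u2)) := by
      have := convexOn_exp.2 (Set.mem_univ (θ * (q1 - u1))) (Set.mem_univ (θ * (q2 - u2)))
        hφ0 hψ0 (by ring)
      simp only [smul_eq_mul] at this
      refine le_trans (le_of_eq ?_) this
      congr 1
      ring
    have hK : 0 ≤ ρ * (σ2 / G h) := by
      have := hG h
      positivity
    have hmax : max (ρ * (σ2 / G h) * (Real.exp (θ * ((φ * q1 + (1 - φ) * q2) -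
          (φ * u1 + (1 - φ) * u2))) - 1) - ((φ * e1 + (1 - φ) * e2) - (φ * η1 + (1 - φ) * η2)) / τ) 0
        ≤ φ * max (ρ * (σ2 / G h) * (Real.exp (θ * (q1 - u1)) - 1) - (e1 - η1) / τ) 0 +
          (1 - φ) * max (ρ * (σ2 / G h) * (Real.exp (θ * (q2 - u2)) - 1) - (e2 - η2) / τ) 0 := by
      apply max_le
      · have m1 := mul_le_mul_of_nonneg_left (le_max_left
          (ρ * (σ2 / G h) * (Real.exp (θ * (q1 - u1)) - 1) - (e1 - η1) / τ) 0) hφ0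
        have m2 := mul_le_mul_of_nonneg_left (le_max_left
          (ρ * (σ2 / G h) * (Real.exp (θ * (q2 - u2)) - 1) - (e2 - η2) / τ) 0) hψ0
        have m3 := mul_le_mul_of_nonneg_left hexp hK
        have m4 : ((φ * e1 + (1 - φ) * e2) - (φ * η1 + (1 - φ) * η2)) / τ =
          φ * ((e1 - η1) / τ) + (1 - φ) * ((e2 - η2) / τ) := by ring
        rw [m4]
        refine le_trans ?_ (add_le_add m1 m2)
        generalize ρ * (σ2 / G h) = K at *
        linarith
      · exact add_nonneg (mul_nonneg hφ0 (le_max_right _ _)) (mul_nonneg hψ0 (le_max_right _ _))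
    have k1 := mul_le_mul_of_nonneg_left hsum hα0.le
    have k2 := mul_le_mul_of_nonneg_left hmax hβ.le
    have k3 := mul_le_mul_of_nonneg_left hz1.le hφ0
    have k4 := mul_le_mul_of_nonneg_left hz2.le hψ0
    refine hle.trans ?_
    refine le_trans (add_le_add (add_le_add le_rfl k2) k1) ?_
    linarith
end

section
/- Suppose (u*, η*) minimizes S over the feasible grid {0,…,q} × {0,…,e_b} and is interior in the sense that 1 ≤ u* ≤ q−1 and 1 ≤ η* ≤ e_b−1. Then the following three double inequalities hold: (i) Z1(u*, η*) ≤ β·ρ·(σ2/G(h))·exp(θq)·(exp(θ) − 1) ≤ Z1(u*+1, η*); (ii) Z2(u*, η*) ≤ −β/τ ≤ Z2(u*, η*+1); (iii) Z3(u*, η*) ≤ β·ρ·(σ2/G(h))·exp(θq)·(exp(θ) − 1) ≤ Z3(u*+1, η*+1). -/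
open Finset

/-- Proposition 1 of the paper: first-order necessary conditions for an interior
discount-optimal action `(u*, η*)` (with `u = q − r` the remaining queue and
`η = e_b − wτ` the remaining battery energy). -/
theorem interior_optimal_action_necessary_conditions {SH SA SE : Type*}
    [Fintype SH] [Fintype SA] [Fintype SE]
    [Nonempty SH] [Nonempty SA] [Nonempty SE]
    (G : SH → ℝ) (hG : ∀ h, 0 < G h)
    (arr : SA → ℕ) (en : SE → ℕ)
    (PH : SH → SH → ℝ) (PA : SA → SA → ℝ) (PE : SE → SE → ℝ)
    (hPH0 : ∀ h h', 0 ≤ PH h h') (hPH1 : ∀ h, ∑ h' : SH, PH h h' = 1)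
    (hPA0 : ∀ a a', 0 ≤ PA a a') (hPA1 : ∀ a, ∑ a' : SA, PA a a' = 1)
    (hPE0 : ∀ e e', 0 ≤ PE e e') (hPE1 : ∀ e, ∑ e' : SE, PE e e' = 1)
    (ρ σ2 θ C τ β α : ℝ) (Emax : ℕ)
    (hρ : 1 ≤ ρ) (hσ2 : 0 < σ2) (hθ : 0 < θ) (hC : 0 ≤ C) (hτ : 0 < τ)
    (hβ : 0 < β) (hα0 : 0 < α) (hα1 : α < 1)
    (Δ : ℕ → ℝ) (hΔ : ∀ r : ℕ, Δ r = if r = 0 then 0 else C)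
    -- the (arbitrary) discounted value function
    (V : ℕ → SH → SA → ℕ → SE → ℝ)
    -- the fixed state
    (q : ℕ) (h : SH) (a : SA) (eb : ℕ) (e : SE)
    (hq : 2 ≤ q) (heb2 : 2 ≤ eb) (hebmax : eb ≤ Emax)
    -- expected continuation cost, one-step value, and the difference functions
    (F : ℕ → ℕ → ℝ)
    (hF : ∀ u η : ℕ, F u η = ∑ h' : SH, ∑ a' : SA, ∑ e' : SE,
      PH h h' * PA a a' * PE e e' * V (u + arr a') h' a' (min (η + en e') Emax) e')
    (S : ℕ → ℕ → ℝ)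
    (hS : ∀ u η : ℕ, S u η = (q : ℝ)
      + β * (ρ * (σ2 / G h) * (Real.exp (θ * ((q - u : ℕ) : ℝ)) - 1)
          + Δ (q - u) - ((eb - η : ℕ) : ℝ) / τ)
      + α * F u η)
    (Z1 Z2 Z3 : ℕ → ℕ → ℝ)
    (hZ1 : ∀ u η : ℕ, Z1 u η = Real.exp (θ * (u : ℝ)) *
      (α * (F u η - F (u - 1) η) + β * (Δ (q - u) - Δ (q - u + 1))))
    (hZ2 : ∀ u η : ℕ, Z2 u η = α * (F u η - F u (η - 1)))
    (hZ3 : ∀ u η : ℕ, Z3 u η = Real.exp (θ * (u : ℝ)) *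
      (α * (F u η - F (u - 1) (η - 1)) + β * (Δ (q - u) - Δ (q - u + 1)) + β / τ))
    -- interior minimizer of S over the feasible grid
    (ustar ηstar : ℕ)
    (hu1 : 1 ≤ ustar) (hu2 : ustar ≤ q - 1)
    (hη1 : 1 ≤ ηstar) (hη2 : ηstar ≤ eb - 1)
    (hmin : ∀ u ≤ q, ∀ η ≤ eb, S ustar ηstar ≤ S u η) :
    (Z1 ustar ηstar ≤ β * ρ * (σ2 / G h) * Real.exp (θ * (q : ℝ)) * (Real.exp θ - 1) ∧
        β * ρ * (σ2 / G h) * Real.exp (θ * (q : ℝ)) * (Real.exp θ - 1) ≤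
          Z1 (ustar + 1) ηstar) ∧
      (Z2 ustar ηstar ≤ -β / τ ∧ -β / τ ≤ Z2 ustar (ηstar + 1)) ∧
      (Z3 ustar ηstar ≤ β * ρ * (σ2 / G h) * Real.exp (θ * (q : ℝ)) * (Real.exp θ - 1) ∧
        β * ρ * (σ2 / G h) * Real.exp (θ * (q : ℝ)) * (Real.exp θ - 1) ≤
          Z3 (ustar + 1) (ηstar + 1)) := by
  have key1 : ∀ u η : ℕ, u + 1 ≤ q →
      Z1 (u + 1) η - β * ρ * (σ2 / G h) * Real.exp (θ * (q : ℝ)) * (Real.exp θ - 1) =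
        Real.exp (θ * ((u + 1 : ℕ) : ℝ)) * (S (u + 1) η - S u η) := by
    intro u η hu
    obtain ⟨m, rfl⟩ := Nat.exists_eq_add_of_le hu
    rw [hZ1, hS, hS]
    have e1 : u + 1 + m - (u + 1) = m := by omega
    have e2 : u + 1 + m - u = m + 1 := by omega
    rw [e1, e2, Nat.add_sub_cancel]
    have x1 : Real.exp (θ * ((u + 1 + m : ℕ) : ℝ)) =
        Real.exp (θ * ((u + 1 : ℕ) : ℝ)) * Real.exp (θ * (m : ℝ)) := by
      rw [← Real.exp_add]; push_cast; ring_nf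
    have x2 : Real.exp (θ * ((m + 1 : ℕ) : ℝ)) = Real.exp (θ * (m : ℝ)) * Real.exp θ := by
      rw [← Real.exp_add]; push_cast; ring_nf
    rw [x1, x2]
    ring
  have key2 : ∀ u η : ℕ, η + 1 ≤ eb →
      Z2 u (η + 1) - (-β / τ) = S u (η + 1) - S u η := by
    intro u η hη
    rw [hZ2, hS, hS, Nat.add_sub_cancel]
    rw [Nat.cast_sub hη, Nat.cast_sub (by omega : η ≤ eb)]
    push_cast
    ring
  have key3 : ∀ u η : ℕ, u + 1 ≤ q → η + 1 ≤ eb →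
      Z3 (u + 1) (η + 1) - β * ρ * (σ2 / G h) * Real.exp (θ * (q : ℝ)) * (Real.exp θ - 1) =
        Real.exp (θ * ((u + 1 : ℕ) : ℝ)) * (S (u + 1) (η + 1) - S u η) := by
    intro u η hu hη
    have k1 := key1 u (η + 1) hu
    have k2 := key2 u η hη
    have k : Z3 (u + 1) (η + 1) = Z1 (u + 1) (η + 1) +
        Real.exp (θ * ((u + 1 : ℕ) : ℝ)) * (Z2 u (η + 1) - (-β / τ)) := by
      rw [hZ1, hZ2, hZ3]
      simp only [Nat.add_sub_cancel]
      ring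
    rw [k, k2]
    linear_combination k1
  obtain ⟨v, rfl⟩ := Nat.exists_eq_add_of_le' hu1
  obtain ⟨ζ, rfl⟩ := Nat.exists_eq_add_of_le' hη1
  have neg : ∀ x y c : ℝ, x ≤ y → Real.exp c * (x - y) ≤ 0 := fun x y c hxy =>
    mul_nonpos_of_nonneg_of_nonpos (Real.exp_pos c).le (by linarith)
  have pos : ∀ x y c : ℝ, y ≤ x → 0 ≤ Real.exp c * (x - y) := fun x y c hxy =>
    mul_nonneg (Real.exp_pos c).le (by linarith)
  refine ⟨⟨?_, ?_⟩, ⟨?_, ?_⟩, ⟨?_, ?_⟩⟩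
  · rw [← sub_nonpos, key1 _ _ (by omega)]
    exact neg _ _ _ (hmin _ (by omega) _ (by omega))
  · rw [← sub_nonneg, key1 _ _ (by omega)]
    exact pos _ _ _ (hmin _ (by omega) _ (by omega))
  · rw [← sub_nonpos, key2 _ _ (by omega), sub_nonpos]
    exact hmin _ (by omega) _ (by omega)
  · rw [← sub_nonneg, key2 _ _ (by omega), sub_nonneg]
    exact hmin _ (by omega) _ (by omega)
  · rw [← sub_nonpos, key3 _ _ (by omega) (by omega)]
    exact neg _ _ _ (hmin _ (by omega) _ (by omega))
  · rw [← sub_nonneg, key3 _ _ (by omega) (by omega)]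
    exact pos _ _ _ (hmin _ (by omega) _ (by omega))
end

section
/- Let F : ℝ → ℝ be convex and let c : ℝ → ℝ be an arbitrary function. For q ≥ 0 define T_q(r) = c(r) + F(q − r) for r ∈ [0, q]. Suppose 0 ≤ q1 < q2, r1 is the unique minimizer of T_{q1} on [0, q1], and r2 is the unique minimizer of T_{q2} on [0, q2]. Then r1 ≤ r2. -/
/-- Monotone comparative statics underlying Proposition 3 / Lemma 7: on a larger queue
the unique minimizer of `T_q(r) = c(r) + F(q − r)` over `[0, q]` is no smaller, where
`F` is convex. -/
theorem optimal_rate_monotone_in_queue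
    (F : ℝ → ℝ) (hF : ConvexOn ℝ Set.univ F) (c : ℝ → ℝ)
    (q1 q2 : ℝ) (hq1 : 0 ≤ q1) (hq12 : q1 < q2)
    (r1 : ℝ) (hr1mem : r1 ∈ Set.Icc (0 : ℝ) q1)
    (hr1 : ∀ r ∈ Set.Icc (0 : ℝ) q1, r ≠ r1 →
      c r1 + F (q1 - r1) < c r + F (q1 - r))
    (r2 : ℝ) (hr2mem : r2 ∈ Set.Icc (0 : ℝ) q2)
    (hr2 : ∀ r ∈ Set.Icc (0 : ℝ) q2, r ≠ r2 →
      c r2 + F (q2 - r2) < c r + F (q2 - r)) :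
    r1 ≤ r2 := by
  by_contra! h
  obtain ⟨h1, h1'⟩ := hr1mem
  obtain ⟨h2, h2'⟩ := hr2mem
  have A := hr1 r2 ⟨h2, by linarith⟩ h.ne
  have B := hr2 r1 ⟨h1, by linarith⟩ h.ne'
  have hd : 0 < r1 - r2 := by linarith
  have he : 0 < q2 - q1 := by linarith
  have hs : 0 < (r1 - r2) + (q2 - q1) := by linarith
  have hsum : (q2 - q1) / ((r1 - r2) + (q2 - q1)) + (r1 - r2) / ((r1 - r2) + (q2 - q1)) = 1 := by
    field_simp
    ring
  have hx := (div_pos he hs).le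
  have hy := (div_pos hd hs).le
  generalize hxe : (q2 - q1) / ((r1 - r2) + (q2 - q1)) = x at *
  generalize hye : (r1 - r2) / ((r1 - r2) + (q2 - q1)) = y at *
  rw [div_eq_iff hs.ne'] at hxe hye
  have C := hF.2 (Set.mem_univ (q1 - r1)) (Set.mem_univ (q2 - r2)) hx hy hsum
  have D := hF.2 (Set.mem_univ (q1 - r1)) (Set.mem_univ (q2 - r2)) hy hx (by linarith)
  have hx1 : x = 1 - y := by linarith
  have e1 : x • (q1 - r1) + y • (q2 - r2) = q1 - r2 := by
    simp only [smul_eq_mul]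
    subst hx1
    linarith
  have e2 : y • (q1 - r1) + x • (q2 - r2) = q2 - r1 := by
    simp only [smul_eq_mul]
    subst hx1
    linarith
  rw [e1] at C
  rw [e2] at D
  simp only [smul_eq_mul] at C D
  subst hx1
  linarith
end

section
/- The greedy battery power allocation wg is feasible, and for every horizon n ∈ ℕ and every feasible battery power allocation sequence w, Σ_{k < n} max(P(k) − wg(k), 0) ≤ Σ_{k < n} max(P(k) − w(k), 0). That is, the greedy allocation simultaneously minimizes the cumulative grid power over every horizon among all feasible allocation sequences. -/
open Finset

/-- Battery levels induced by a power allocation sequence `w`: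
`e(0) = e0`, `e(k+1) = min(e(k) − w(k)·τ + Earr(k), Emax)`. -/
noncomputable def batteryLevels (τ Emax e0 : ℝ) (Earr : ℕ → ℝ) (w : ℕ → ℝ) : ℕ → ℝ
  | 0 => e0
  | k + 1 => min (batteryLevels τ Emax e0 Earr w k - w k * τ + Earr k) Emax

/-- A battery power allocation sequence is feasible if it is nonnegative and never draws
more than the available battery power in each slot. -/
def FeasibleAlloc (τ Emax e0 : ℝ) (Earr : ℕ → ℝ) (w : ℕ → ℝ) : Prop :=
  ∀ k : ℕ, 0 ≤ w k ∧ w k ≤ batteryLevels τ Emax e0 Earr w k / τ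

/-- Battery levels of the greedy allocation `wg(k) = min(eg(k)/τ, P(k))`. -/
noncomputable def greedyLevels (τ Emax e0 : ℝ) (P Earr : ℕ → ℝ) : ℕ → ℝ
  | 0 => e0
  | k + 1 => min (greedyLevels τ Emax e0 P Earr k
      - min (greedyLevels τ Emax e0 P Earr k / τ) (P k) * τ + Earr k) Emax

/-- The greedy battery power allocation. -/
noncomputable def greedyAlloc (τ Emax e0 : ℝ) (P Earr : ℕ → ℝ) (k : ℕ) : ℝ :=
  min (greedyLevels τ Emax e0 P Earr k / τ) (P k)

theorem gb_step (τ P E M eg ew w g : ℝ) (hτ : 0 < τ) (hg : g = min (eg / τ) P)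
    (hw1 : w ≤ ew / τ) :
    τ * max (P - g) 0 + max (min (ew - w * τ + E) M - min (eg - g * τ + E) M) 0
      ≤ max (ew - eg) 0 + τ * max (P - w) 0 := by
  have h1 : w * τ ≤ ew := (le_div_iff₀ hτ).1 hw1
  have hA : max (min (ew - w * τ + E) M - min (eg - g * τ + E) M) 0
      ≤ max ((ew - w * τ) - (eg - g * τ)) 0 := by
    grind
  have hgP : g ≤ P := hg ▸ min_le_right _ _
  have h2 : τ * (P - w) ≤ τ * max (P - w) 0 :=
    mul_le_mul_of_nonneg_left (le_max_left _ _) hτ.le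
  have h3 : 0 ≤ τ * max (P - w) 0 := mul_nonneg hτ.le (le_max_right _ _)
  have h4 := le_max_left (ew - eg) 0
  have h5 := le_max_right (ew - eg) 0
  rw [max_eq_left (sub_nonneg.2 hgP)]
  refine (add_le_add_right hA _).trans ?_
  rcases min_choice (eg / τ) P with h | h
  · have hgt : g * τ = eg := by rw [hg, h]; field_simp
    rw [max_eq_left (by linarith)]
    nlinarith
  · have hgt : g = P := by rw [hg, h]
    subst hgt
    rcases max_choice ((ew - w * τ) - (eg - g * τ)) 0 with h | h <;> rw [h] <;> nlinarith

theorem gb_levels (τ Emax e0 : ℝ) (P Earr : ℕ → ℝ) (k : ℕ) :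
    batteryLevels τ Emax e0 Earr (greedyAlloc τ Emax e0 P Earr) k
      = greedyLevels τ Emax e0 P Earr k := by
  induction k with
  | zero => rfl
  | succ k ih => simp only [batteryLevels, greedyLevels, ih, greedyAlloc]

theorem gb_nonneg (τ Emax e0 : ℝ) (P Earr : ℕ → ℝ) (hτ : 0 < τ) (hEmax : 0 ≤ Emax)
    (he0 : 0 ≤ e0) (hE : ∀ k, 0 ≤ Earr k) (k : ℕ) :
    0 ≤ greedyLevels τ Emax e0 P Earr k := by
  cases k with
  | zero => exact he0
  | succ k =>
    simp only [greedyLevels]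
    refine le_min ?_ hEmax
    have := (le_div_iff₀ hτ).1 (min_le_left (greedyLevels τ Emax e0 P Earr k / τ) (P k))
    linarith [hE k]

/-- Deterministic pathwise dominance behind Lemma 9: the greedy battery power allocation
is feasible and, over every horizon `n`, its cumulative grid power
`Σ_{k<n} max(P(k) − wg(k), 0)` is no larger than that of any feasible allocation. -/
theorem greedy_alloc_pathwise_optimal (τ Emax e0 : ℝ) (P Earr : ℕ → ℝ)
    (hτ : 0 < τ) (hEmax : 0 ≤ Emax) (he0 : 0 ≤ e0) (he0' : e0 ≤ Emax)
    (hP : ∀ k, 0 ≤ P k) (hE : ∀ k, 0 ≤ Earr k) :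
    FeasibleAlloc τ Emax e0 Earr (greedyAlloc τ Emax e0 P Earr) ∧
      ∀ n : ℕ, ∀ w : ℕ → ℝ, FeasibleAlloc τ Emax e0 Earr w →
        ∑ k ∈ Finset.range n, max (P k - greedyAlloc τ Emax e0 P Earr k) 0 ≤
          ∑ k ∈ Finset.range n, max (P k - w k) 0 := by
  refine ⟨fun k => ⟨?_, ?_⟩, fun n w hw => ?_⟩
  · exact le_min (div_nonneg (gb_nonneg τ Emax e0 P Earr hτ hEmax he0 hE k) hτ.le) (hP k)
  · rw [gb_levels]
    exact min_le_left _ _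
  · have key : ∀ n : ℕ, τ * ∑ k ∈ Finset.range n, max (P k - greedyAlloc τ Emax e0 P Earr k) 0
        + max (batteryLevels τ Emax e0 Earr w n - greedyLevels τ Emax e0 P Earr n) 0
        ≤ τ * ∑ k ∈ Finset.range n, max (P k - w k) 0 := by
      intro n
      induction n with
      | zero => simp [batteryLevels, greedyLevels]
      | succ n ih =>
        have := gb_step τ (P n) (Earr n) Emax (greedyLevels τ Emax e0 P Earr n)
          (batteryLevels τ Emax e0 Earr w n) (w n) (greedyAlloc τ Emax e0 P Earr n) hτ rfl
          (hw n).2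
        rw [Finset.sum_range_succ, Finset.sum_range_succ, mul_add, mul_add]
        simp only [batteryLevels, greedyLevels]
        simp only [greedyAlloc] at this ih ⊢
        linarith
    have h0 := le_max_right (batteryLevels τ Emax e0 Earr w n - greedyLevels τ Emax e0 P Earr n) 0
    exact le_of_mul_le_mul_left (by linarith [key n]) hτ
end

section
/- When β = 0, for every n ≥ 0 and every state (q, h, a, e_b, e), the minimum in the recursion defining V_{n+1}(q, h, a, e_b, e) is attained at an action with η = e_b (i.e. zero battery power allocation, w = 0): for every u ∈ {0,…,q} and every η ∈ {0,…,e_b}, the objective evaluated at (u, e_b) is less than or equal to the objective evaluated at (u, η). -/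
open Finset

theorem dpV_zero_price_antitone {SH SA SE : Type*}
    [Fintype SH] [Fintype SA] [Fintype SE]
    (G : SH → ℝ) (arr : SA → ℕ) (en : SE → ℕ)
    (PH : SH → SH → ℝ) (PA : SA → SA → ℝ) (PE : SE → SE → ℝ)
    (ρ σ2 θ C τ α : ℝ) (Emax : ℕ)
    (n q : ℕ) (h : SH) (a : SA) (e : SE) (x y : ℕ) (hxy : x ≤ y) :
    dpV G arr en PH PA PE ρ σ2 θ C τ 0 α Emax n q h a y e ≤
      dpV G arr en PH PA PE ρ σ2 θ C τ 0 α Emax n q h a x e := by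
  cases n with
  | zero => simp [dpV]
  | succ n =>
    simp only [dpV]
    apply Finset.le_inf'
    rintro ⟨u, η⟩ hp
    simp only [Finset.mem_product, Finset.mem_range] at hp
    refine (Finset.inf'_le _ (b := (u, η)) ?_).trans ?_
    · simp only [Finset.mem_product, Finset.mem_range]
      omega
    · simp [dpObj]

/-- Core of the second assertion of Lemma 10: when the grid-power price vanishes
(`β = 0`), for every `n ≥ 0` and every state `(q,h,a,e_b,e)` with `e_b ≤ Emax`, the
minimum in the Bellman recursion defining `V_{n+1}` is attained at an action with
`η = e_b` (i.e. zero battery power allocation `w = 0`): for every `u ∈ {0,…,q}` and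
`η ∈ {0,…,e_b}`, the objective at `(u, e_b)` is at most the objective at `(u, η)`. -/
theorem zero_price_reserve_battery_optimal {SH SA SE : Type*}
    [Fintype SH] [Fintype SA] [Fintype SE]
    [Nonempty SH] [Nonempty SA] [Nonempty SE]
    (G : SH → ℝ) (hG : ∀ h, 0 < G h)
    (arr : SA → ℕ) (en : SE → ℕ)
    (PH : SH → SH → ℝ) (PA : SA → SA → ℝ) (PE : SE → SE → ℝ)
    (hPH0 : ∀ h h', 0 ≤ PH h h') (hPH1 : ∀ h, ∑ h' : SH, PH h h' = 1)
    (hPA0 : ∀ a a', 0 ≤ PA a a') (hPA1 : ∀ a, ∑ a' : SA, PA a a' = 1)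
    (hPE0 : ∀ e e', 0 ≤ PE e e') (hPE1 : ∀ e, ∑ e' : SE, PE e e' = 1)
    (ρ σ2 θ C τ α : ℝ) (Emax : ℕ)
    (hρ : 1 ≤ ρ) (hσ2 : 0 < σ2) (hθ : 0 < θ) (hC : 0 ≤ C) (hτ : 0 < τ)
    (hα0 : 0 < α) (hα1 : α < 1)
    (n : ℕ) (q : ℕ) (h : SH) (a : SA) (e : SE) (eb : ℕ) (heb : eb ≤ Emax)
    (u η : ℕ) (hu : u ≤ q) (hη : η ≤ eb) :
    dpObj G arr en PH PA PE ρ σ2 θ C τ 0 α Emax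
        (dpV G arr en PH PA PE ρ σ2 θ C τ 0 α Emax n) q h a eb e u eb ≤
      dpObj G arr en PH PA PE ρ σ2 θ C τ 0 α Emax
        (dpV G arr en PH PA PE ρ σ2 θ C τ 0 α Emax n) q h a eb e u η := by
  unfold dpObj
  simp only [zero_mul]
  gcongr with h' _ a' _ e' _
  · exact mul_nonneg (mul_nonneg (hPH0 _ _) (hPA0 _ _)) (hPE0 _ _)
  · exact dpV_zero_price_antitone G arr en PH PA PE ρ σ2 θ C τ α Emax n _ _ _ _ _ _
      (by omega)
end
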